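/- Quasi-positivity of elements of a finitely generated free group F(X) with respect to a basis X is decidable: there is an algorithm that, given a word w over X ∪ X⁻¹, determines whether or not w represents a quasi-positive element of F(X). -/

import Mathlib

/-- Quasi-positive: a (possibly empty) product of conjugates of generators. -/
def QuasiPositive {X : Type*} (w : FreeGroup X) : Prop :=
  ∃ l : List (X × FreeGroup X),
    w = (l.map fun p => p.2⁻¹ * FreeGroup.of p.1 * p.2).prod

open FreeGroup

/-- `PosDel w w'` says that `w'` arises from the word `w` by deleting some positive letters. -/
inductive PosDel {X : Type*} : List (X × Bool) → List (X × Bool) → Prop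
  | nil : PosDel [] []
  | cons (a : X × Bool) {l l' : List (X × Bool)} : PosDel l l' → PosDel (a :: l) (a :: l')
  | skip (x : X) {l l' : List (X × Bool)} : PosDel l l' → PosDel ((x, true) :: l) l'

namespace PosDel

variable {X : Type*} {u v w u' v' : List (X × Bool)}

theorem refl : ∀ l : List (X × Bool), PosDel l l
  | [] => nil
  | a :: l => cons a (refl l)

theorem append (hu : PosDel u u') (hv : PosDel v v') : PosDel (u ++ v) (u' ++ v') := by
  induction hu with
  | nil => exact hv
  | cons a _ ih => exact cons a ih
  | skip x _ ih => exact skip x ih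

theorem trans (huv : PosDel u v) (hvw : PosDel v w) : PosDel u w := by
  induction huv generalizing w with
  | nil => exact hvw
  | cons a _ ih =>
    cases hvw with
    | cons _ h => exact cons a (ih h)
    | skip x h => exact skip x (ih h)
  | skip x _ ih => exact skip x (ih hvw)

theorem exists_of_append (h : PosDel (u ++ v) w) :
    ∃ u' v', w = u' ++ v' ∧ PosDel u u' ∧ PosDel v v' := by
  induction u generalizing w with
  | nil => exact ⟨[], w, rfl, nil, h⟩
  | cons a u ih =>
    cases h with
    | cons _ h =>
      obtain ⟨u', v', rfl, hu, hv⟩ := ih h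
      exact ⟨a :: u', v', rfl, cons a hu, hv⟩
    | skip x h =>
      obtain ⟨u', v', rfl, hu, hv⟩ := ih h
      exact ⟨u', v', rfl, skip x hu, hv⟩

theorem delete (u : List (X × Bool)) (x : X) (v : List (X × Bool)) :
    PosDel (u ++ (x, true) :: v) (u ++ v) :=
  (refl u).append (skip x (refl v))

end PosDel

section

variable {X : Type*}

/-- A word reducing to a single letter contains that letter between two trivial words. -/
theorem exists_eq_append_cons_of_red_singleton {W : List (X × Bool)} {y : X × Bool}
    (h : Red W [y]) :
    ∃ a b, W = a ++ y :: b ∧ FreeGroup.mk a = 1 ∧ FreeGroup.mk b = 1 := by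
  rw [show [y] = [] ++ ([y] ++ []) from rfl] at h
  induction h using Relation.ReflTransGen.head_induction_on with
  | refl => exact ⟨[], [], rfl, rfl, rfl⟩
  | head hs _ ih =>
    obtain ⟨a, b, hab, ha, hb⟩ := ih
    obtain @⟨L₁, L₂, x, c⟩ := hs
    have key : ∀ p q : List (X × Bool),
        FreeGroup.mk (p ++ (x, c) :: (x, !c) :: q) = FreeGroup.mk (p ++ q) :=
      fun p q => Quot.sound Red.Step.not
    rcases List.append_eq_append_iff.1 hab with ⟨m, rfl, rfl⟩ | ⟨m, rfl, hm⟩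
    · exact ⟨L₁ ++ (x, c) :: (x, !c) :: m, b, by simp, by rw [key, ha], hb⟩
    · cases m with
      | nil =>
        simp only [List.nil_append] at hm
        subst hm
        exact ⟨a ++ (x, c) :: (x, !c) :: [], b, by simp, by rw [key, List.append_nil, ha], hb⟩
      | cons z m =>
        simp only [List.cons_append, List.cons.injEq] at hm
        obtain ⟨rfl, rfl⟩ := hm
        exact ⟨a, m ++ (x, c) :: (x, !c) :: L₂, by simp, ha, by rw [key, hb]⟩

/-- In a trivial word, a negative letter can be removed together with a positive letter. -/
theorem exists_posDel_of_mk_eq_one {u v : List (X × Bool)} {x : X}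
    (h : FreeGroup.mk (u ++ (x, false) :: v) = 1) :
    ∃ u' v', PosDel u u' ∧ PosDel v v' ∧ FreeGroup.mk (u' ++ v') = 1 := by
  have hx : FreeGroup.mk (v ++ u) = FreeGroup.mk [(x, true)] := by
    rw [show u ++ (x, false) :: v = u ++ ([(x, false)] ++ v) from rfl, ← mul_mk, ← mul_mk] at h
    have hinv : (FreeGroup.mk [(x, false)] : FreeGroup X) = (FreeGroup.mk [(x, true)])⁻¹ := rfl
    rw [hinv] at h
    rw [← mul_mk, eq_comm]
    generalize FreeGroup.mk [(x, true)] = g at *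
    generalize FreeGroup.mk u = p at *
    generalize FreeGroup.mk v = q at *
    have hp : p = q⁻¹ * g := by
      rw [eq_inv_of_mul_eq_one_left h]
      group
    rw [hp]
    group
  have hred : Red (v ++ u) [(x, true)] := by
    obtain ⟨c, h₁, h₂⟩ := Red.exact.1 hx
    rwa [Red.singleton_iff.1 h₂] at h₁
  obtain ⟨a, b, hab, ha, hb⟩ := exists_eq_append_cons_of_red_singleton hred
  rcases List.append_eq_append_iff.1 hab with ⟨m, rfl, rfl⟩ | ⟨m, rfl, hm⟩
  · refine ⟨m ++ b, v, .delete _ _ _, .refl _, ?_⟩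
    rw [← mul_mk] at ha
    rw [← mul_mk, ← mul_mk, hb, mul_one]
    exact mul_eq_one_comm.1 ha
  · cases m with
    | nil =>
      simp only [List.nil_append] at hm
      subst hm
      refine ⟨b, a, .skip x (.refl b), by simpa using PosDel.refl a, ?_⟩
      rw [← mul_mk, ha, hb, mul_one]
    | cons z m =>
      simp only [List.cons_append, List.cons.injEq] at hm
      obtain ⟨rfl, rfl⟩ := hm
      refine ⟨u, a ++ m, .refl u, .delete _ _ _, ?_⟩
      rw [← mul_mk] at hb
      rw [← mul_mk, ← mul_mk, ha, one_mul]
      exact mul_eq_one_comm.1 hb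

/-- Deleting suitable positive letters turns the word into one representing `1`. -/
def PosTrivializable (w : List (X × Bool)) : Prop :=
  ∃ w', PosDel w w' ∧ FreeGroup.mk w' = 1

theorem PosTrivializable.append {u v : List (X × Bool)} (hu : PosTrivializable u)
    (hv : PosTrivializable v) : PosTrivializable (u ++ v) := by
  obtain ⟨u', hu, hu1⟩ := hu
  obtain ⟨v', hv, hv1⟩ := hv
  exact ⟨u' ++ v', hu.append hv, by rw [← mul_mk, hu1, hv1, one_mul]⟩

theorem posTrivializable_iff_of_step {w₁ w₂ : List (X × Bool)} (h : Red.Step w₁ w₂) :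
    PosTrivializable w₁ ↔ PosTrivializable w₂ := by
  obtain @⟨u, v, x, c⟩ := h
  have key : ∀ p q : List (X × Bool),
      FreeGroup.mk (p ++ (x, c) :: (x, !c) :: q) = FreeGroup.mk (p ++ q) :=
    fun p q => Quot.sound Red.Step.not
  constructor
  · rintro ⟨w, hw, hw1⟩
    obtain ⟨u', t, rfl, hu, ht⟩ := hw.exists_of_append
    have aux : ∀ v', PosDel v v' → FreeGroup.mk (u' ++ (x, false) :: v') = 1 →
        PosTrivializable (u ++ v) := by
      intro v' hv h1
      obtain ⟨u₂, v₂, hu₂, hv₂, h⟩ := exists_posDel_of_mk_eq_one h1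
      exact ⟨u₂ ++ v₂, (hu.trans hu₂).append (hv.trans hv₂), h⟩
    cases c with
    | true =>
      cases ht with
      | cons _ ht =>
        cases ht with
        | cons _ ht => exact ⟨_, hu.append ht, by rw [← key, ← hw1]⟩
      | skip _ ht =>
        cases ht with
        | cons _ ht => exact aux _ ht hw1
    | false =>
      cases ht with
      | cons _ ht =>
        cases ht with
        | cons _ ht => exact ⟨_, hu.append ht, by rw [← key, ← hw1]⟩
        | skip _ ht => exact aux _ ht hw1
  · rintro ⟨w, hw, hw1⟩
    obtain ⟨u', v', rfl, hu, hv⟩ := hw.exists_of_append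
    exact ⟨_, hu.append (.cons (x, c) (.cons (x, !c) hv)), by rw [key, hw1]⟩

theorem posTrivializable_iff_of_mk_eq {w₁ w₂ : List (X × Bool)}
    (h : FreeGroup.mk w₁ = FreeGroup.mk w₂) : PosTrivializable w₁ ↔ PosTrivializable w₂ := by
  have lift : ∀ {a b : List (X × Bool)}, Red a b → (PosTrivializable a ↔ PosTrivializable b) := by
    intro a b hab
    induction hab with
    | refl => rfl
    | tail _ hs ih => exact ih.trans (posTrivializable_iff_of_step hs)
  obtain ⟨c, h₁, h₂⟩ := Red.exact.1 h
  exact (lift h₁).trans (lift h₂).symm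

theorem PosDel.quasiPositive {w w' : List (X × Bool)} (h : PosDel w w') :
    ∃ q : FreeGroup X, QuasiPositive q ∧ FreeGroup.mk w = q * FreeGroup.mk w' := by
  induction h with
  | nil => exact ⟨1, ⟨[], rfl⟩, rfl⟩
  | @cons a l l' _ ih =>
    obtain ⟨_, ⟨L, rfl⟩, h⟩ := ih
    have hc : ∀ t, FreeGroup.mk (a :: t) = FreeGroup.mk [a] * FreeGroup.mk t := fun t => by
      rw [mul_mk]; rfl
    refine ⟨FreeGroup.mk [a] * (L.map fun p => p.2⁻¹ * FreeGroup.of p.1 * p.2).prod *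
      (FreeGroup.mk [a])⁻¹, ⟨L.map fun p => (p.1, p.2 * (FreeGroup.mk [a])⁻¹), ?_⟩, ?_⟩
    · rw [← MulAut.conj_apply, map_list_prod, List.map_map, List.map_map]
      congr 2
      funext p
      simp [mul_assoc]
    · rw [hc l, hc l', h]
      group
  | @skip x l l' _ ih =>
    obtain ⟨_, ⟨L, rfl⟩, h⟩ := ih
    refine ⟨_, ⟨(x, 1) :: L, rfl⟩, ?_⟩
    have hc : FreeGroup.mk ((x, true) :: l) = FreeGroup.of x * FreeGroup.mk l := by
      rw [FreeGroup.of, mul_mk]; rfl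
    rw [hc, h]
    simp [mul_assoc]

theorem quasiPositive_mk_iff (w : List (X × Bool)) :
    QuasiPositive (FreeGroup.mk w) ↔ PosTrivializable w := by
  constructor
  · rintro ⟨L, hL⟩
    suffices h : ∃ v, FreeGroup.mk v = (L.map fun p => p.2⁻¹ * FreeGroup.of p.1 * p.2).prod ∧
        PosTrivializable v by
      obtain ⟨v, hv, hv'⟩ := h
      exact (posTrivializable_iff_of_mk_eq (hL.trans hv.symm)).2 hv'
    clear hL
    induction L with
    | nil => exact ⟨[], rfl, [], .nil, rfl⟩
    | cons p L ih =>
      obtain ⟨v, hv, hv'⟩ := ih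
      obtain ⟨x, g⟩ := p
      obtain ⟨g, rfl⟩ : ∃ t, FreeGroup.mk t = g := Quot.exists_rep g
      refine ⟨(invRev g ++ (x, true) :: g) ++ v, ?_,
        .append ⟨_, .delete _ _ _, ?_⟩ hv'⟩
      · rw [List.map_cons, List.prod_cons, ← hv, FreeGroup.of, inv_mk, mul_mk, mul_mk, mul_mk]
        simp
      · rw [← mul_mk, ← inv_mk, inv_mul_cancel]
  · rintro ⟨w', h, h1⟩
    obtain ⟨q, hq, hw⟩ := h.quasiPositive
    rwa [hw, h1, mul_one]

end

section

variable {X : Type} [DecidableEq X]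

/-- Prepend a letter to a reduced word and reduce. -/
def pushLetter (a : X × Bool) (l : List (X × Bool)) : List (X × Bool) :=
  List.casesOn l [a] fun b t => if a.1 = b.1 ∧ a.2 = !b.2 then t else a :: b :: t

/-- The reduced forms of all words obtained by deleting positive letters. -/
def posDelReduced (w : List (X × Bool)) : List (List (X × Bool)) :=
  w.foldr (fun a S => S.map (pushLetter a) ++ if a.2 = true then S else []) [[]]

theorem reduce_cons_eq_pushLetter (a : X × Bool) (l : List (X × Bool)) :
    reduce (a :: l) = pushLetter a (reduce l) := by
  rw [reduce.cons]
  rfl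

theorem mem_posDelReduced_iff {w r : List (X × Bool)} :
    r ∈ posDelReduced w ↔ ∃ w', PosDel w w' ∧ reduce w' = r := by
  unfold posDelReduced
  induction w generalizing r with
  | nil =>
    constructor
    · intro h
      exact ⟨[], .nil, (List.mem_singleton.1 h).symm⟩
    · rintro ⟨_, ⟨⟩, rfl⟩
      simp
  | cons a w ih =>
    simp only [List.foldr_cons, List.mem_append, List.mem_map]
    constructor
    · rintro (⟨s, hs, rfl⟩ | h)
      · obtain ⟨w', hw, rfl⟩ := ih.1 hs
        exact ⟨a :: w', .cons a hw, reduce_cons_eq_pushLetter a w'⟩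
      · obtain ⟨x, c⟩ := a
        cases c with
        | false => simp at h
        | true =>
          obtain ⟨w', hw, rfl⟩ := ih.1 (by simpa using h)
          exact ⟨w', .skip x hw, rfl⟩
    · rintro ⟨w', hw, rfl⟩
      cases hw with
      | cons _ h => exact .inl ⟨_, ih.2 ⟨_, h, rfl⟩, (reduce_cons_eq_pushLetter _ _).symm⟩
      | skip x h => exact .inr (by simpa using ih.2 ⟨_, h, rfl⟩)

theorem primrec_pushLetter [Primcodable X] : Primrec₂ (pushLetter (X := X)) := by
  have ha : Primrec fun q : ((X × Bool) × List (X × Bool)) × (X × Bool) × List (X × Bool) =>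
      q.1.1 := Primrec.fst.comp Primrec.fst
  have hb : Primrec fun q : ((X × Bool) × List (X × Bool)) × (X × Bool) × List (X × Bool) =>
      q.2.1 := Primrec.fst.comp Primrec.snd
  have ht : Primrec fun q : ((X × Bool) × List (X × Bool)) × (X × Bool) × List (X × Bool) =>
      q.2.2 := Primrec.snd.comp Primrec.snd
  have hcons : Primrec₂ fun (p : (X × Bool) × List (X × Bool))
      (q : (X × Bool) × List (X × Bool)) =>
        if p.1.1 = q.1.1 ∧ p.1.2 = !q.1.2 then q.2 else p.1 :: q.1 :: q.2 :=
    Primrec.ite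
      ((Primrec.eq.comp (Primrec.fst.comp ha) (Primrec.fst.comp hb)).and
        (Primrec.eq.comp (Primrec.snd.comp ha) (Primrec.not.comp (Primrec.snd.comp hb))))
      ht (Primrec.list_cons.comp ha (Primrec.list_cons.comp hb ht))
  exact Primrec.list_casesOn Primrec.snd
    (Primrec.list_cons.comp Primrec.fst (Primrec.const [])) hcons

theorem primrec_posDelReduced [Primcodable X] : Primrec (posDelReduced (X := X)) := by
  have ha : Primrec fun q : List (X × Bool) × (X × Bool) × List (List (X × Bool)) => q.2.1 :=
    Primrec.fst.comp Primrec.snd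
  have hS : Primrec fun q : List (X × Bool) × (X × Bool) × List (List (X × Bool)) => q.2.2 :=
    Primrec.snd.comp Primrec.snd
  have hstep : Primrec₂ fun (_ : List (X × Bool))
      (q : (X × Bool) × List (List (X × Bool))) =>
        q.2.map (pushLetter q.1) ++ if q.1.2 = true then q.2 else [] :=
    Primrec.list_append.comp
      (Primrec.list_map hS (primrec_pushLetter.comp (ha.comp Primrec.fst) Primrec.snd))
      (Primrec.ite (Primrec.eq.comp (Primrec.snd.comp ha) (Primrec.const true)) hS
        (Primrec.const []))
  exact Primrec.list_foldr Primrec.id (Primrec.const [[]]) hstep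

theorem quasiPositive_mk_iff_nil_mem (w : List (X × Bool)) :
    QuasiPositive (FreeGroup.mk w) ↔ ∃ r ∈ posDelReduced w, r = [] := by
  rw [quasiPositive_mk_iff, exists_eq_right, mem_posDelReduced_iff]
  refine exists_congr fun w' => and_congr_right fun _ => ?_
  rw [← toWord_mk, toWord_eq_nil_iff]

end

/-- Quasi-positivity is decidable: the set of words over `X ∪ X⁻¹` (a letter
`(x, tt)` is `x`, a letter `(x, ff)` is `x⁻¹`) representing quasi-positive
elements of the free group on a finite basis `X` is computable. -/
theorem quasiPositive_decidable (X : Type) [Fintype X] [DecidableEq X] [Primcodable X] :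
    ComputablePred fun l : List (X × Bool) => QuasiPositive (FreeGroup.mk l) := by
  have hnil : PrimrecPred fun r : List (X × Bool) => r = [] :=
    Primrec.eq.comp Primrec.id (Primrec.const [])
  obtain ⟨_, h⟩ := hnil.exists_mem_list.comp primrec_posDelReduced
  exact ComputablePred.of_eq ⟨_, h.to_comp⟩ fun w => (quasiPositive_mk_iff_nil_mem w).symm
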